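/- Let T be a tournament on a set V of n players, where n is a power of two, and let K be a 3-king of T. Let A = N_out(K), let B = N_out(A) ∩ N_in(K) be the set of players that beat K but are beaten by some player of A, and let C = N_in(K) \ B. If (1) |A| ≥ n/2, (2) every player of A beats every player of B, and (3) |B| ≥ |C|, then K is an SE winner of T. -/

import Mathlib

/-- A tournament relation on `V`: irreflexive, asymmetric, and total. -/
structure IsTournament {V : Type*} (beats : V → V → Prop) : Prop where
  irrefl : ∀ v, ¬ beats v v
  asymm : ∀ u v, beats u v → ¬ beats v u
  total : ∀ u v, u ≠ v → beats u v ∨ beats v u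

/-- `SEWinner beats S v` : the player `v` can win a balanced single-elimination
tournament among the players of `S` under some seeding.  Either `S = {v}`, or `S`
can be partitioned into pairs (via a fixed-point-free involution `f` of `S`) such
that `v` is an SE winner of the set `W` of winners of the pairs. -/
inductive SEWinner {V : Type*} (beats : V → V → Prop) : Finset V → V → Prop
  | single (v : V) : SEWinner beats {v} v
  | round (S W : Finset V) (f : V → V) (v : V)
      (hf : ∀ x ∈ S, f x ∈ S ∧ f x ≠ x ∧ f (f x) = x)
      (hW : ∀ x, x ∈ W ↔ x ∈ S ∧ beats x (f x))
      (hw : SEWinner beats W v) : SEWinner beats S v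

/-- A king: every other player is beaten by `v` or by someone `v` beats. -/
def IsKing {V : Type*} (beats : V → V → Prop) (v : V) : Prop :=
  ∀ u, u ≠ v → beats v u ∨ ∃ w, beats v w ∧ beats w u

/-- A 3-king: every other player is reachable from `v` in at most 3 steps. -/
def IsThreeKing {V : Type*} (beats : V → V → Prop) (v : V) : Prop :=
  ∀ u, u ≠ v → beats v u ∨ (∃ w, beats v w ∧ beats w u) ∨
    ∃ w x, beats v w ∧ beats w x ∧ beats x u

/-- The out-degree of a player. -/
noncomputable def outDeg {V : Type*} [Fintype V] (beats : V → V → Prop) (v : V) : ℕ :=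
  {u | beats v u}.ncard

/-- The number of directed `k`-paths originating at `v`. -/
noncomputable def kPathCount {V : Type*} [Fintype V] (beats : V → V → Prop) (k : ℕ) (v : V) : ℕ :=
  {p : Fin (k + 1) → V | Function.Injective p ∧ p 0 = v ∧
    ∀ i : Fin k, beats (p i.castSucc) (p i.succ)}.ncard

/-- A superking: a king `v` such that every player beating `v` is beaten by at
least `log₂ n` players whom `v` beats. -/
def IsSuperking {V : Type*} [Fintype V] (beats : V → V → Prop) (v : V) : Prop :=
  IsKing beats v ∧ ∀ u, beats u v →
    Real.logb 2 (Fintype.card V) ≤ ({w | beats v w ∧ beats w u}.ncard : ℝ)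

/-- A single round: `S` is partitioned into pairs and `W` is the set of winners of the pairs. -/
inductive Rd {V : Type*} [DecidableEq V] (beats : V → V → Prop) : Finset V → Finset V → Prop
  | nil : Rd beats ∅ ∅
  | cons (S W : Finset V) (x y : V) (hx : x ∉ S) (hy : y ∉ S) (hxy : x ≠ y)
      (hb : beats x y) (h : Rd beats S W) : Rd beats (insert x (insert y S)) (insert x W)

section
variable {V : Type*} [DecidableEq V] {beats : V → V → Prop}

theorem Rd.subset {S W : Finset V} (h : Rd beats S W) : W ⊆ S := by
  induction h with
  | nil => simp
  | cons S W x y hx hy hxy hb h ih =>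
    intro z hz
    have := @ih z
    grind

theorem Rd.card {S W : Finset V} (h : Rd beats S W) : S.card = 2 * W.card := by
  induction h with
  | nil => simp
  | cons S W x y hx hy hxy hb h ih =>
    have hxW : x ∉ W := fun h' => hx (h.subset h')
    rw [Finset.card_insert_of_notMem (by simp [hx, hxy]), Finset.card_insert_of_notMem hy,
      Finset.card_insert_of_notMem hxW]
    omega

theorem Rd.union {S W S' W' : Finset V} (h : Rd beats S W) (h' : Rd beats S' W')
    (hd : Disjoint S S') : Rd beats (S ∪ S') (W ∪ W') := by
  induction h with
  | nil => simpa using h'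
  | cons S W x y hx hy hxy hb h ih =>
    simp only [Finset.disjoint_insert_left] at hd
    rw [Finset.insert_union, Finset.insert_union, Finset.insert_union]
    exact Rd.cons _ _ x y (by simp [hx, hd.1]) (by simp [hy, hd.2.1]) hxy hb (ih hd.2.2)

theorem Rd.pair {x y : V} (hxy : x ≠ y) (hb : beats x y) : Rd beats {x, y} {x} := by
  simpa using Rd.cons ∅ ∅ x y (by simp) (by simp) hxy hb Rd.nil

theorem Rd.invol (hT : IsTournament beats) {S W : Finset V} (h : Rd beats S W) :
    ∃ f : V → V, (∀ x ∈ S, f x ∈ S ∧ f x ≠ x ∧ f (f x) = x) ∧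
      (∀ x, x ∈ W ↔ x ∈ S ∧ beats x (f x)) := by
  induction h with
  | nil => exact ⟨id, by simp, by simp⟩
  | cons S W x y hx hy hxy hb h ih =>
    obtain ⟨f, hf, hW⟩ := ih
    refine ⟨fun z => if z = x then y else if z = y then x else f z, ?_, ?_⟩
    · intro z hz
      have := hf z
      grind
    · intro z
      have h1 := hW z
      have h2 := hT.asymm x y hb
      by_cases hzx : z = x
      · subst hzx; simp [hb]
      · by_cases hzy : z = y
        · subst hzy
          have : z ∉ W := fun h' => hy (h.subset h')
          simp [hzx, this, h2]
        · simp [hzx, hzy, h1]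

theorem Rd.even (hT : IsTournament beats) : ∀ (n : ℕ) (S : Finset V), S.card = 2 * n →
    ∃ W, Rd beats S W := by
  intro n
  induction n with
  | zero =>
    intro S hS
    have : S = ∅ := by simpa using hS
    subst this
    exact ⟨∅, Rd.nil⟩
  | succ n ih =>
    intro S hS
    obtain ⟨x, hx⟩ : S.Nonempty := Finset.card_pos.1 (by omega)
    have h1 := Finset.card_erase_of_mem hx
    obtain ⟨y, hy⟩ : (S.erase x).Nonempty := Finset.card_pos.1 (by omega)
    have h2 := Finset.card_erase_of_mem hy
    obtain ⟨W, hW⟩ := ih ((S.erase x).erase y) (by omega)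
    have hyx : y ≠ x := Finset.ne_of_mem_erase hy
    have hyS := Finset.mem_of_mem_erase hy
    rcases hT.total x y hyx.symm with hb | hb
    · refine ⟨insert x W, ?_⟩
      have := Rd.cons _ _ x y (by simp) (by simp) hyx.symm hb hW
      rwa [Finset.insert_erase hy, Finset.insert_erase hx] at this
    · refine ⟨insert y W, ?_⟩
      have := Rd.cons _ _ y x (by simp) (by simp) hyx hb hW
      rwa [Finset.insert_comm, Finset.insert_erase hy, Finset.insert_erase hx] at this

/-- A maximal matching from `B` to `C`. -/
theorem Rd.matching : ∀ (n : ℕ) (B C : Finset V), B.card = n → Disjoint B C →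
    ∃ B1 C1, B1 ⊆ B ∧ C1 ⊆ C ∧ B1.card = C1.card ∧ Rd beats (B1 ∪ C1) B1 ∧
      ∀ b ∈ B \ B1, ∀ c ∈ C \ C1, ¬ beats b c := by
  intro n
  induction n with
  | zero =>
    intro B C hB _
    have : B = ∅ := by simpa using hB
    subst this
    exact ⟨∅, ∅, by simp, by simp, rfl, by simpa using Rd.nil, by simp⟩
  | succ n ih =>
    intro B C hB hd
    by_cases hex : ∃ b ∈ B, ∃ c ∈ C, beats b c
    · obtain ⟨b, hb, c, hc, hbc⟩ := hex
      have hdd := Finset.disjoint_left.1 hd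
      obtain ⟨B1, C1, hB1, hC1, hcd, hR, hmax⟩ := ih (B.erase b) (C.erase c)
        (by rw [Finset.card_erase_of_mem hb]; omega)
        (hd.mono (Finset.erase_subset _ _) (Finset.erase_subset _ _))
      have hbB1 : b ∉ B1 := fun h => by simpa using hB1 h
      have hcC1 : c ∉ C1 := fun h => by simpa using hC1 h
      have hbC1 : b ∉ C1 := fun h => hdd hb (Finset.mem_of_mem_erase (hC1 h))
      have hcB1 : c ∉ B1 := fun h => hdd (Finset.mem_of_mem_erase (hB1 h)) hc
      have hne : b ≠ c := fun h => hdd hb (h ▸ hc)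
      refine ⟨insert b B1, insert c C1, ?_, ?_, ?_, ?_, ?_⟩
      · intro z hz
        have := @hB1 z
        grind
      · intro z hz
        have := @hC1 z
        grind
      · rw [Finset.card_insert_of_notMem hbB1, Finset.card_insert_of_notMem hcC1, hcd]
      · have := Rd.cons _ _ b c (by simp [hbB1, hbC1]) (by simp [hcC1, hcB1]) hne hbc hR
        rwa [Finset.insert_union, Finset.union_insert]
      · intro b' hb' c' hc'
        apply hmax <;> grind
    · push Not at hex
      exact ⟨∅, ∅, by simp, by simp, rfl, by simpa using Rd.nil, by simpa using hex⟩

/-- The unmatched members of `C` play each other, a possible leftover plays a member of `U`. -/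
theorem Rd.stepC (hT : IsTournament beats) (U X : Finset V) (hd : Disjoint U X)
    (hle : X.card ≤ U.card) (hno : ∀ b ∈ U, ∀ c ∈ X, ¬ beats b c) :
    ∃ U1 C2, U1 ⊆ U ∧ C2 ⊆ X ∧ Rd beats ((U \ U1) ∪ X) C2 ∧
      U1.card + X.card % 2 = U.card ∧ 2 * C2.card = X.card + X.card % 2 := by
  have hdd := Finset.disjoint_left.1 hd
  rcases Nat.mod_two_eq_zero_or_one X.card with h0 | h0
  · obtain ⟨W, hW⟩ := Rd.even hT (X.card / 2) X (by omega)
    have := hW.card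
    exact ⟨U, W, le_rfl, hW.subset, by simpa using hW, by omega, by omega⟩
  · obtain ⟨c, hc⟩ : X.Nonempty := Finset.card_pos.1 (by omega)
    obtain ⟨u, hu⟩ : U.Nonempty := Finset.card_pos.1 (by omega)
    have e1 := Finset.card_erase_of_mem hc
    have e2 := Finset.card_erase_of_mem hu
    obtain ⟨W, hW⟩ := Rd.even hT (X.card / 2) (X.erase c) (by omega)
    have hcu : c ≠ u := fun h => hdd hu (h ▸ hc)
    have hb : beats c u := (hT.total c u hcu).resolve_right (hno u hu c hc)
    have hs := hW.subset
    have hcW : c ∉ W := fun h => by simpa using hs h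
    have hwc := hW.card
    have huX : u ∉ X := hdd hu
    have hR := Rd.cons _ _ c u (by simp) (by simp [huX]) hcu hb hW
    refine ⟨U.erase u, insert c W, Finset.erase_subset _ _, ?_, ?_, by omega, ?_⟩
    · intro z hz
      have := @hs z
      grind
    · convert hR using 1
      ext z
      grind
    · rw [Finset.card_insert_of_notMem hcW]; omega

/-- The unmatched members of `B` play each other, a possible leftover loses against `A`. -/
theorem Rd.stepB (hT : IsTournament beats) (A U : Finset V) (hd : Disjoint A U)
    (hne : A.Nonempty) (hAB : ∀ a ∈ A, ∀ b ∈ U, beats a b) :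
    ∃ A1 B2, A1 ⊆ A ∧ B2 ⊆ U ∧ Rd beats (A1 ∪ U) (A1 ∪ B2) ∧
      A1.card = U.card % 2 ∧ 2 * B2.card + U.card % 2 = U.card := by
  have hdd := Finset.disjoint_left.1 hd
  rcases Nat.mod_two_eq_zero_or_one U.card with h0 | h0
  · obtain ⟨W, hW⟩ := Rd.even hT (U.card / 2) U (by omega)
    have := hW.card
    exact ⟨∅, W, by simp, hW.subset, by simpa using hW, by simp [h0], by omega⟩
  · obtain ⟨a, ha⟩ := hne
    obtain ⟨u, hu⟩ : U.Nonempty := Finset.card_pos.1 (by omega)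
    have e2 := Finset.card_erase_of_mem hu
    obtain ⟨W, hW⟩ := Rd.even hT (U.card / 2) (U.erase u) (by omega)
    have hau : a ≠ u := fun h => hdd ha (h ▸ hu)
    have hwc := hW.card
    have hR := Rd.cons _ _ a u (by simp [hdd ha]) (by simp) hau (hAB a ha u hu) hW
    rw [Finset.insert_erase hu] at hR
    exact ⟨{a}, W, by simpa using ha, hW.subset.trans (Finset.erase_subset _ _),
      by simpa [Finset.singleton_union] using hR, by simp [h0], by omega⟩

theorem se_main (hT : IsTournament beats) (K : V) : ∀ (k : ℕ) (A B C : Finset V),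
    K ∉ A → K ∉ B → K ∉ C → Disjoint A B → Disjoint A C → Disjoint B C →
    A.card + B.card + C.card + 1 = 2 ^ k → 2 ^ k / 2 ≤ A.card →
    (∀ a ∈ A, beats K a) → (∀ a ∈ A, ∀ b ∈ B, beats a b) →
    (∀ c ∈ C, ∃ b ∈ B, beats b c) → C.card ≤ B.card →
    SEWinner beats (insert K (A ∪ B ∪ C)) K := by
  intro k
  induction k with
  | zero =>
    intro A B C _ _ _ _ _ _ hc _ _ _ _ _
    have hA : A = ∅ := by rw [← Finset.card_eq_zero]; omega
    have hB : B = ∅ := by rw [← Finset.card_eq_zero]; omega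
    have hC : C = ∅ := by rw [← Finset.card_eq_zero]; omega
    subst hA hB hC
    simpa using SEWinner.single K
  | succ k ih =>
    intro A B C hKA hKB hKC dAB dAC dBC hcard hA hKbA hAB hBC hle
    have hpow : 2 ^ (k + 1) = 2 * 2 ^ k := by ring
    have hpos : 0 < 2 ^ k := by positivity
    have hAne : A.Nonempty := Finset.card_pos.1 (by omega)
    obtain ⟨B1, C1, hB1, hC1, hc1, hR1, hmax⟩ := Rd.matching (beats := beats) _ B C rfl dBC
    have eB := Finset.card_sdiff_add_card_eq_card hB1
    have eC := Finset.card_sdiff_add_card_eq_card hC1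
    obtain ⟨U1, C2, hU1, hC2, hR2, hu1, hc2⟩ := Rd.stepC hT (B \ B1) (C \ C1)
      (dBC.mono Finset.sdiff_subset Finset.sdiff_subset) (by omega) hmax
    have hU1B : U1 ⊆ B := hU1.trans Finset.sdiff_subset
    obtain ⟨A1, B2, hA1, hB2, hR3, ha1, hb2⟩ := Rd.stepB hT A U1 (dAB.mono le_rfl hU1B) hAne
      (fun a ha b hb => hAB a ha b (hU1B hb))
    have eA := Finset.card_sdiff_add_card_eq_card hA1
    have hodd : (A \ A1).card % 2 = 1 := by omega
    obtain ⟨a0, ha0⟩ : (A \ A1).Nonempty := Finset.card_pos.1 (by omega)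
    have e0 := Finset.card_erase_of_mem ha0
    obtain ⟨A2, hR4⟩ := Rd.even hT ((A \ A1).card / 2) ((A \ A1).erase a0) (by omega)
    have hA2 := hR4.subset
    have ha2 := hR4.card
    have ha0A : a0 ∈ A := (Finset.mem_sdiff.1 ha0).1
    have ha0A1 : a0 ∉ A1 := (Finset.mem_sdiff.1 ha0).2
    have hKa0 : K ≠ a0 := fun h => hKA (h ▸ ha0A)
    have hR5 := Rd.cons _ _ K a0 (by simp [hKA]) (by simp) hKa0 (hKbA a0 ha0A) hR4
    rw [Finset.insert_erase ha0] at hR5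
    simp only [Finset.disjoint_left] at dAB dAC dBC
    have s1 := fun z => @hB1 z
    have s2 := fun z => @hC1 z
    have s3 := fun z => @hU1 z
    have s4 := fun z => @hC2 z
    have s5 := fun z => @hA1 z
    have s6 := fun z => @hB2 z
    have s7 := fun z => @hA2 z
    simp only [Finset.mem_sdiff, Finset.mem_erase] at s3 s4 s7
    have P : ∀ z, (z = K → z ∉ A ∧ z ∉ B ∧ z ∉ C) ∧ (z ∈ A → z ∉ B) ∧ (z ∈ A → z ∉ C) ∧
        (z ∈ B → z ∉ C) ∧ (z ∈ B1 → z ∈ B) ∧ (z ∈ C1 → z ∈ C) ∧ (z ∈ U1 → z ∈ B ∧ z ∉ B1) ∧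
        (z ∈ C2 → z ∈ C ∧ z ∉ C1) ∧ (z ∈ A1 → z ∈ A) ∧ (z ∈ B2 → z ∈ U1) ∧
        (z ∈ A2 → z ≠ a0 ∧ z ∈ A ∧ z ∉ A1) := fun z =>
      ⟨fun h => h ▸ ⟨hKA, hKB, hKC⟩, @dAB z, @dAC z, @dBC z, s1 z, s2 z, s3 z, s4 z, s5 z, s6 z,
        s7 z⟩
    have hRR := ((hR5.union hR3 (by
        rw [Finset.disjoint_left]; intro z; have := P z; clear * - this; grind)).union hR1 (by
        rw [Finset.disjoint_left]; intro z; have := P z; clear * - this; grind)).union hR2 (by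
        rw [Finset.disjoint_left]; intro z; have := P z; clear * - this; grind)
    obtain ⟨f, hf, hW⟩ := hRR.invol hT
    have key : SEWinner beats (insert K ((A1 ∪ A2) ∪ (B1 ∪ B2) ∪ C2)) K := by
      have cA : (A1 ∪ A2).card = A1.card + A2.card := by
        apply Finset.card_union_of_disjoint
        rw [Finset.disjoint_left]; intro z; have := P z; clear * - this; grind
      have cB : (B1 ∪ B2).card = B1.card + B2.card := by
        apply Finset.card_union_of_disjoint
        rw [Finset.disjoint_left]; intro z; have := P z; clear * - this; grind
      apply ih
      · have := P K; clear * - this; grind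
      · have := P K; clear * - this; grind
      · have := P K; clear * - this; grind
      · rw [Finset.disjoint_left]; intro z; have := P z; clear * - this; grind
      · rw [Finset.disjoint_left]; intro z; have := P z; clear * - this; grind
      · rw [Finset.disjoint_left]; intro z; have := P z; clear * - this; grind
      · omega
      · rcases k with _ | k
        · simp
        · have : 2 ^ (k + 1) = 2 * 2 ^ k := by ring
          omega
      · intro a ha; apply hKbA; have := P a; clear * - this ha; grind
      · intro a ha b hb; apply hAB
        · have := P a; clear * - this ha; grind
        · have := P b; clear * - this hb; grind
      · intro c hc
        obtain ⟨hcC, hcC1⟩ := s4 c hc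
        obtain ⟨b, hb, hbc⟩ := hBC c hcC
        refine ⟨b, ?_, hbc⟩
        by_contra hbB
        exact hmax b (by clear * - hb hbB; grind) c (by clear * - hcC hcC1; grind) hbc
      · have : C.card = 0 ∨ 0 < B1.card := by
          rcases Nat.eq_zero_or_pos B1.card with h | h
          · left
            by_contra hne
            obtain ⟨c, hc⟩ : C.Nonempty := Finset.card_pos.1 (by omega)
            obtain ⟨b, hb, hbc⟩ := hBC c hc
            have h1 : B1 = ∅ := Finset.card_eq_zero.1 h
            have h2 : C1 = ∅ := Finset.card_eq_zero.1 (by omega)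
            exact hmax b (by simp [h1, hb]) c (by simp [h2, hc]) hbc
          · exact Or.inr h
        omega
    have eW : insert K A2 ∪ (A1 ∪ B2) ∪ B1 ∪ C2 = insert K ((A1 ∪ A2) ∪ (B1 ∪ B2) ∪ C2) := by
      ext z
      clear * -
      grind
    have eS : insert K (A ∪ B ∪ C) =
        insert K (A \ A1) ∪ (A1 ∪ U1) ∪ (B1 ∪ C1) ∪ ((B \ B1) \ U1 ∪ C \ C1) := by
      ext z
      have := P z
      clear * - this
      grind
    rw [← eW] at key
    rw [eS]
    exact SEWinner.round _ _ f K hf hW key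
end

/-- a structural result for 3-kings (Theorem 2 of the paper). -/
theorem threeKing_SE_winner {V : Type*} [Fintype V]
    (beats : V → V → Prop) (hT : IsTournament beats)
    (k : ℕ) (hcard : Fintype.card V = 2 ^ k)
    (K : V) (hking : IsThreeKing beats K)
    (A B C : Set V)
    (hA : A = {u | beats K u})
    (hB : B = {u | beats u K ∧ ∃ a ∈ A, beats a u})
    (hC : C = {u | beats u K} \ B)
    (h1 : Fintype.card V ≤ 2 * A.ncard)
    (h2 : ∀ a ∈ A, ∀ b ∈ B, beats a b)
    (h3 : C.ncard ≤ B.ncard) :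
    SEWinner beats Finset.univ K := by
  classical
  have nAB : ∀ z, z ∈ A → z ∉ B := by
    intro z hz hz'
    rw [hA] at hz
    rw [hB] at hz'
    exact hT.asymm _ _ hz hz'.1
  have nAC : ∀ z, z ∈ A → z ∉ C := by
    intro z hz hz'
    rw [hA] at hz
    rw [hC] at hz'
    exact hT.asymm _ _ hz hz'.1
  have nBC : ∀ z, z ∈ B → z ∉ C := by
    intro z hz hz'
    rw [hC] at hz'
    exact hz'.2 hz
  have kA : K ∉ A := by
    rw [hA]; exact hT.irrefl K
  have kB : K ∉ B := by
    rw [hB]; exact fun h => hT.irrefl K h.1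
  have kC : K ∉ C := by
    rw [hC]; exact fun h => hT.irrefl K h.1
  have hall : ∀ z, z = K ∨ (z ∈ A ∨ z ∈ B) ∨ z ∈ C := by
    intro z
    by_cases hz : z = K
    · exact Or.inl hz
    · right
      rcases hT.total z K hz with h | h
      · by_cases hzB : z ∈ B
        · exact Or.inl (Or.inr hzB)
        · right; rw [hC]; exact ⟨h, hzB⟩
      · left; left; rw [hA]; exact h
  have hCB : ∀ c ∈ C, ∃ b ∈ B, beats b c := by
    intro c hc
    have hcK : c ≠ K := fun h => kC (h ▸ hc)
    have hcb : beats c K := by rw [hC] at hc; exact hc.1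
    have hcA : ∀ a ∈ A, ¬ beats a c := fun a ha hac =>
      nBC c (by rw [hB]; exact ⟨hcb, a, ha, hac⟩) hc
    rcases hking c hcK with h | ⟨w, hw, hwc⟩ | ⟨w, x, hw, hwx, hxc⟩
    · exact absurd h (hT.asymm _ _ hcb)
    · exact absurd hwc (hcA w (by rw [hA]; exact hw))
    · have hwA : w ∈ A := by rw [hA]; exact hw
      rcases hall x with h | (h | h) | h
      · subst h; exact absurd hwx (hT.asymm _ _ hw)
      · exact absurd hxc (hcA x h)
      · exact ⟨x, h, hxc⟩
      · exfalso
        rw [hC] at h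
        exact h.2 (by rw [hB]; exact ⟨h.1, w, hwA, hwx⟩)
  rw [Set.ncard_eq_toFinset_card'] at h1
  rw [Set.ncard_eq_toFinset_card', Set.ncard_eq_toFinset_card'] at h3
  have dAB : Disjoint A.toFinset B.toFinset := by
    rw [Finset.disjoint_left]; simpa using nAB
  have dAC : Disjoint A.toFinset C.toFinset := by
    rw [Finset.disjoint_left]; simpa using nAC
  have dBC : Disjoint B.toFinset C.toFinset := by
    rw [Finset.disjoint_left]; simpa using nBC
  have huniv : (Finset.univ : Finset V) = insert K (A.toFinset ∪ B.toFinset ∪ C.toFinset) := by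
    ext z
    simpa [or_assoc] using hall z
  have hc : A.toFinset.card + B.toFinset.card + C.toFinset.card + 1 = 2 ^ k := by
    rw [← hcard, ← Finset.card_univ, huniv, Finset.card_insert_of_notMem (by simp [kA, kB, kC]),
      Finset.card_union_of_disjoint (Finset.disjoint_union_left.2 ⟨dAC, dBC⟩),
      Finset.card_union_of_disjoint dAB]
  rw [huniv]
  apply se_main hT K k A.toFinset B.toFinset C.toFinset (by simpa using kA) (by simpa using kB)
    (by simpa using kC) dAB dAC dBC hc (by omega)
  · intro a ha
    rw [Set.mem_toFinset, hA] at ha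
    exact ha
  · intro a ha b hb
    exact h2 a (by simpa using ha) b (by simpa using hb)
  · intro c hc'
    simpa using hCB c (by simpa using hc')
  · exact h3
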